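/- Let L n be the number of λ-terms of natural size n. Then the n-th root (L n)^{1/n} tends to 1/ρ as n → ∞, i.e. the exponential growth rate of the number of λ-terms is 1/ρ ≈ 3.38298. -/

import Mathlib

inductive Term : Type
  | idx : ℕ → Term
  | app : Term → Term → Term
  | abs : Term → Term

def Term.size : Term → ℕ
  | .idx n => n + 1
  | .app t u => t.size + u.size + 1
  | .abs t => t.size + 1

noncomputable def L (n : ℕ) : ℕ := Nat.card {t : Term // t.size = n}

open Finset.HasAntidiagonal in
/-- The root decomposition of the terms of size `n + 1`. -/
def termOfParts (n : ℕ) :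
    Unit ⊕ {t : Term // t.size = n} ⊕
      (Σ p : antidiagonal n, {t : Term // t.size = p.1.1} × {t : Term // t.size = p.1.2}) →
    {t : Term // t.size = n + 1}
  | .inl _ => ⟨.idx n, rfl⟩
  | .inr (.inl t) => ⟨.abs t.1, congrArg (· + 1) t.2⟩
  | .inr (.inr ⟨p, t, u⟩) => ⟨.app t.1 u.1, by
      rw [Term.size, t.2, u.2, mem_antidiagonal.1 p.2]⟩

theorem termOfParts_bijective (n : ℕ) : Function.Bijective (termOfParts n) := by
  constructor
  · rintro (_ | ⟨t, ht⟩ | ⟨⟨⟨i, j⟩, hp⟩, ⟨t, ht⟩, ⟨u, hu⟩⟩)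
      (_ | ⟨t', ht'⟩ | ⟨⟨⟨i', j'⟩, hp'⟩, ⟨t', ht'⟩, ⟨u', hu'⟩⟩) h <;>
      replace h := congrArg Subtype.val h <;>
      simp only [termOfParts, reduceCtorEq, Term.abs.injEq, Term.app.injEq] at h
    · rfl
    · subst h; rfl
    · obtain ⟨rfl, rfl⟩ := h
      dsimp only at ht hu ht' hu'
      subst ht hu ht' hu'
      rfl
  · rintro ⟨k | ⟨t, u⟩ | t, ht⟩
    · obtain rfl : k = n := by simpa [Term.size] using ht
      exact ⟨.inl (), rfl⟩
    · have h : t.size + u.size = n := by simpa [Term.size] using ht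
      exact ⟨.inr (.inr ⟨⟨(t.size, u.size), Finset.HasAntidiagonal.mem_antidiagonal.2 h⟩,
        ⟨t, rfl⟩, ⟨u, rfl⟩⟩), rfl⟩
    · have h : t.size = n := by simpa [Term.size] using ht
      exact ⟨.inr (.inl ⟨t, h⟩), rfl⟩

theorem Term.size_pos (t : Term) : 0 < t.size := by
  cases t <;> simp [Term.size]

instance isEmpty_size_zero : IsEmpty {t : Term // t.size = 0} :=
  ⟨fun t => t.1.size_pos.ne' t.2⟩

instance finite_size_eq (n : ℕ) : Finite {t : Term // t.size = n} := by
  induction n using Nat.strong_induction_on with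
  | _ n ih =>
    cases n with
    | zero => infer_instance
    | succ n =>
      have := ih n n.lt_succ_self
      have (p : Finset.HasAntidiagonal.antidiagonal n) :
          Finite ({t : Term // t.size = p.1.1} × {t : Term // t.size = p.1.2}) := by
        have := Finset.HasAntidiagonal.mem_antidiagonal.1 p.2
        have := ih p.1.1 (by omega)
        have := ih p.1.2 (by omega)
        infer_instance
      exact Finite.of_surjective _ (termOfParts_bijective n).2

theorem L_zero : L 0 = 0 := Nat.card_of_isEmpty

theorem L_succ (n : ℕ) :
    L (n + 1) = 1 + (L n + ∑ p ∈ Finset.HasAntidiagonal.antidiagonal n, L p.1 * L p.2) := by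
  have h := Nat.card_eq_of_bijective _ (termOfParts_bijective n)
  rw [Nat.card_sum, Nat.card_sum, Nat.card_sigma, Nat.card_unique] at h
  simp only [Nat.card_prod] at h
  rw [L, ← h, ← Finset.sum_coe_sort (Finset.HasAntidiagonal.antidiagonal n)]
  rfl

theorem L_pos {n : ℕ} (hn : n ≠ 0) : 0 < L n := by
  obtain ⟨n, rfl⟩ := Nat.exists_eq_succ_of_ne_zero hn
  rw [L_succ]
  omega

theorem L_le_succ (n : ℕ) : L n ≤ L (n + 1) := by
  rw [L_succ]
  omega

theorem L_mul_le (m n : ℕ) : L m * L n ≤ L (m + n + 1) := by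
  rw [L_succ]
  have := Finset.single_le_sum (f := fun p : ℕ × ℕ => L p.1 * L p.2) (fun _ _ => Nat.zero_le _)
    (Finset.HasAntidiagonal.mem_antidiagonal.2 (rfl : (m, n).1 + (m, n).2 = m + n))
  dsimp only at this
  omega

theorem L_succ_mul_pow (z : ℝ) (n : ℕ) :
    L (n + 1) * z ^ (n + 1) = z * z ^ n + z * (L n * z ^ n) +
      z * ∑ p ∈ Finset.HasAntidiagonal.antidiagonal n, L p.1 * z ^ p.1 * (L p.2 * z ^ p.2) := by
  have h : ∑ p ∈ Finset.HasAntidiagonal.antidiagonal n, L p.1 * z ^ p.1 * (L p.2 * z ^ p.2) =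
      (∑ p ∈ Finset.HasAntidiagonal.antidiagonal n, (L p.1 * L p.2 : ℝ)) * z ^ n := by
    rw [Finset.sum_mul]
    refine Finset.sum_congr rfl fun p hp => ?_
    rw [← Finset.HasAntidiagonal.mem_antidiagonal.1 hp]
    ring
  rw [h, L_succ]
  push_cast
  ring

/-- The partial sums of a Cauchy square are at most the squares of the partial sums. -/
theorem sum_range_sum_antidiagonal_mul_le {f : ℕ → ℝ} (hf : ∀ n, 0 ≤ f n) (N : ℕ) :
    ∑ n ∈ Finset.range N, ∑ p ∈ Finset.HasAntidiagonal.antidiagonal n, f p.1 * f p.2 ≤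
      (∑ n ∈ Finset.range N, f n) ^ 2 := by
  rw [sq, Finset.sum_mul_sum, ← Finset.sum_product']
  refine le_trans (Finset.sum_le_sum fun n hn => ?_)
    (Finset.sum_fiberwise_le_sum_of_sum_fiber_nonneg (t := Finset.range N)
      (g := fun p : ℕ × ℕ => p.1 + p.2)
      fun _ _ => Finset.sum_nonneg fun p _ => mul_nonneg (hf p.1) (hf p.2))
  refine Finset.sum_le_sum_of_subset_of_nonneg (fun p hp => ?_)
    fun p _ _ => mul_nonneg (hf p.1) (hf p.2)
  simp only [Finset.HasAntidiagonal.mem_antidiagonal, Finset.mem_range, Finset.mem_filter,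
    Finset.mem_product] at hp hn ⊢
  omega

theorem sum_range_L_mul_pow_le {ρ : ℝ} (hρ : ρ ∈ Set.Ioo (0 : ℝ) 1)
    (hroot : ρ ^ 3 + ρ ^ 2 + 3 * ρ = 1) (N : ℕ) :
    ∑ n ∈ Finset.range N, L n * ρ ^ n ≤ (1 - ρ) / (2 * ρ) := by
  obtain ⟨h0, h1⟩ := hρ
  have h1' : 0 < 1 - ρ := sub_pos.2 h1
  induction N with
  | zero => simpa using by positivity
  | succ N ih =>
    have hnn (n : ℕ) : 0 ≤ L n * ρ ^ n := by positivity
    have hS : 0 ≤ ∑ n ∈ Finset.range N, L n * ρ ^ n := Finset.sum_nonneg fun n _ => hnn n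
    have hgeom : ∑ n ∈ Finset.range N, ρ ^ n ≤ (1 - ρ)⁻¹ :=
      (tsum_geometric_of_lt_one h0.le h1) ▸
        (summable_geometric_of_lt_one h0.le h1).sum_le_tsum _ fun n _ => by positivity
    have hgeom' : (1 - ρ)⁻¹ = (1 - ρ) ^ 2 / (4 * ρ ^ 2) := by
      field_simp
      linear_combination hroot
    rw [Finset.sum_range_succ', L_zero]
    simp_rw [L_succ_mul_pow]
    rw [Finset.sum_add_distrib, Finset.sum_add_distrib, ← Finset.mul_sum, ← Finset.mul_sum,
      ← Finset.mul_sum]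
    calc _ ≤ ρ * ((1 - ρ) ^ 2 / (4 * ρ ^ 2)) + ρ * ((1 - ρ) / (2 * ρ)) +
          ρ * ((1 - ρ) / (2 * ρ)) ^ 2 + (0 : ℕ) * ρ ^ 0 := by
          gcongr
          · exact hgeom.trans_eq hgeom'
          · exact (sum_range_sum_antidiagonal_mul_le hnn N).trans (by gcongr)
      _ = (1 - ρ) / (2 * ρ) := by
          push_cast
          field_simp
          ring

theorem L_mul_pow_succ_le_one {ρ : ℝ} (hρ : ρ ∈ Set.Ioo (0 : ℝ) 1)
    (hroot : ρ ^ 3 + ρ ^ 2 + 3 * ρ = 1) (n : ℕ) : L n * ρ ^ (n + 1) ≤ 1 := by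
  have h0 := hρ.1
  have h : L n * ρ ^ n ≤ (1 - ρ) / (2 * ρ) :=
    (Finset.single_le_sum (f := fun n => L n * ρ ^ n) (fun n _ => by positivity)
      (Finset.self_mem_range_succ n)).trans (sum_range_L_mul_pow_le hρ hroot (n + 1))
  rw [le_div_iff₀ (by positivity)] at h
  rw [pow_succ]
  linarith

/-- The generating function of `L` satisfies a quadratic equation, whose discriminant is
nonnegative wherever the series converges. -/
theorem le_one_of_summable_L_mul_pow {z : ℝ} (h0 : 0 < z) (h1 : z < 1)
    (hs : Summable fun n => L n * z ^ n) : z ^ 3 + z ^ 2 + 3 * z ≤ 1 := by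
  have h1' : 0 < 1 - z := sub_pos.2 h1
  have hg := summable_geometric_of_lt_one h0.le h1
  have hn : Summable fun n => ‖L n * z ^ n‖ := hs.norm
  have hc := (summable_norm_sum_mul_antidiagonal_of_summable_norm hn hn).of_norm
  have hmul := tsum_mul_tsum_eq_tsum_sum_antidiagonal_of_summable_norm hn hn
  have hy := hs.tsum_eq_zero_add
  simp_rw [L_succ_mul_pow] at hy
  rw [((hg.mul_left z).add (hs.mul_left z)).tsum_add (hc.mul_left z),
    (hg.mul_left z).tsum_add (hs.mul_left z), tsum_mul_left, tsum_mul_left, tsum_mul_left,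
    ← hmul, tsum_geometric_of_lt_one h0.le h1, L_zero] at hy
  set y := ∑' n, L n * z ^ n
  have hinv : (1 - z) * (1 - z)⁻¹ = 1 := mul_inv_cancel₀ h1'.ne'
  have hsq : 0 ≤ (1 - z) * (2 * z * y - (1 - z)) ^ 2 := by positivity
  have : (1 - z) * (2 * z * y - (1 - z)) ^ 2 = 1 - (z ^ 3 + z ^ 2 + 3 * z) := by
    push_cast at hy
    linear_combination (-4 * z * (1 - z)) * hy - 4 * z ^ 2 * hinv
  linarith

theorem subadditive_neg_log_L : Subadditive fun n => -Real.log (L (n - 1)) := by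
  have hmono (n : ℕ) : Real.log (L (n - 1)) ≤ Real.log (L n) := by
    obtain _ | _ | n := n
    · rfl
    · simp [L_zero, Real.log_natCast_nonneg]
    · have := L_pos n.succ_ne_zero
      exact Real.log_le_log (mod_cast this) (mod_cast L_le_succ (n + 1))
  intro m n
  obtain _ | _ | m := m
  · simp [L_zero]
  · simpa [L_zero, add_comm 1 n] using hmono n
  obtain _ | _ | n := n
  · simp [L_zero]
  · simpa [L_zero] using hmono (m + 2)
  have hm := L_pos m.succ_ne_zero
  have hn := L_pos n.succ_ne_zero
  have h : (L (m + 1) * L (n + 1) : ℝ) ≤ L (m + 1 + 1 + (n + 1 + 1) - 1) := by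
    have := L_mul_le (m + 1) (n + 1)
    rw [show m + 1 + (n + 1) + 1 = m + 1 + 1 + (n + 1 + 1) - 1 by omega] at this
    exact_mod_cast this
  have hlog := Real.log_le_log (by positivity) h
  rw [Real.log_mul (by positivity) (by positivity)] at hlog
  simp only [Nat.add_sub_cancel]
  linarith

theorem log_le_neg_log_L_div {ρ : ℝ} (hρ : ρ ∈ Set.Ioo (0 : ℝ) 1)
    (hroot : ρ ^ 3 + ρ ^ 2 + 3 * ρ = 1) (n : ℕ) :
    Real.log ρ ≤ -Real.log (L (n - 1)) / n := by
  have hlog := Real.log_neg hρ.1 hρ.2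
  obtain _ | _ | n := n
  · simpa using hlog.le
  · simpa [L_zero] using hlog.le
  have hL : (L (n + 1) : ℝ) ≠ 0 := mod_cast (L_pos n.succ_ne_zero).ne'
  have h0 := hρ.1
  have h := Real.log_nonpos (by positivity) (L_mul_pow_succ_le_one hρ hroot (n + 1))
  rw [Real.log_mul hL (by positivity), Real.log_pow] at h
  rw [le_div_iff₀ (by positivity), Nat.add_sub_cancel]
  linarith

theorem subadditive_neg_log_L_lim {ρ : ℝ} (hρ : ρ ∈ Set.Ioo (0 : ℝ) 1)
    (hroot : ρ ^ 3 + ρ ^ 2 + 3 * ρ = 1) : subadditive_neg_log_L.lim = Real.log ρ := by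
  have hbdd : BddBelow (Set.range fun n : ℕ => -Real.log (L (n - 1)) / n) :=
    ⟨Real.log ρ, Set.forall_mem_range.2 (log_le_neg_log_L_div hρ hroot)⟩
  refine le_antisymm ?_
    (ge_of_tendsto' (subadditive_neg_log_L.tendsto_lim hbdd) (log_le_neg_log_L_div hρ hroot))
  by_contra! hlt
  set l := subadditive_neg_log_L.lim
  have hlt' : ρ < Real.exp l := (Real.log_lt_iff_lt_exp hρ.1).1 hlt
  obtain ⟨z, hz, hzmin⟩ := exists_between (lt_min hlt' hρ.2)
  obtain ⟨hzl, hz1⟩ := lt_min_iff.1 hzmin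
  have hz0 : 0 < z := hρ.1.trans hz
  have hle (n : ℕ) : L n * z ^ n ≤ Real.exp (-l) * (z / Real.exp l) ^ n := by
    have hL : (L n : ℝ) ≤ Real.exp (-l) * (Real.exp l)⁻¹ ^ n := by
      rcases (L n).eq_zero_or_pos with h | h
      · rw [h, Nat.cast_zero]
        positivity
      have h2 := subadditive_neg_log_L.lim_le_div hbdd n.succ_ne_zero
      rw [le_div_iff₀ (by positivity), Nat.succ_sub_one] at h2
      rw [← Real.exp_neg, ← Real.exp_nat_mul, ← Real.exp_add,
        ← Real.log_le_iff_le_exp (mod_cast h)]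
      push_cast at h2
      linarith
    calc L n * z ^ n ≤ Real.exp (-l) * (Real.exp l)⁻¹ ^ n * z ^ n := by gcongr
      _ = Real.exp (-l) * (z / Real.exp l) ^ n := by
        rw [mul_assoc, ← mul_pow, div_eq_inv_mul]
  have hs : Summable fun n => L n * z ^ n :=
    .of_nonneg_of_le (fun n => by positivity) hle <|
      (summable_geometric_of_lt_one (by positivity)
        ((div_lt_one (Real.exp_pos l)).2 hzl)).mul_left _
  have h := le_one_of_summable_L_mul_pow hz0 hz1 hs
  have h0 := hρ.1
  have : ρ ^ 3 + ρ ^ 2 + 3 * ρ < z ^ 3 + z ^ 2 + 3 * z := by gcongr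
  linarith

theorem L_exponential_growth (ρ : ℝ) (hρ : ρ ∈ Set.Ioo (0 : ℝ) 1)
    (hroot : ρ ^ 3 + ρ ^ 2 + 3 * ρ = 1) :
    Filter.Tendsto (fun n : ℕ => (L n : ℝ) ^ ((1 : ℝ) / n)) Filter.atTop
      (nhds (1 / ρ)) := by
  have hbdd : BddBelow (Set.range fun n : ℕ => -Real.log (L (n - 1)) / n) :=
    ⟨Real.log ρ, Set.forall_mem_range.2 (log_le_neg_log_L_div hρ hroot)⟩
  have hlim := (subadditive_neg_log_L.tendsto_lim hbdd).comp (Filter.tendsto_add_atTop_nat 1)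
  rw [subadditive_neg_log_L_lim hρ hroot] at hlim
  have hratio : Filter.Tendsto (fun n : ℕ => ((n : ℝ) + 1) / n) Filter.atTop (nhds 1) := by
    simpa using (tendsto_natCast_div_add_atTop (1 : ℝ)).inv₀ one_ne_zero
  have hexp := (Real.continuous_exp.tendsto _).comp (hlim.mul hratio).neg
  rw [mul_one, Real.exp_neg, Real.exp_log hρ.1, ← one_div] at hexp
  refine hexp.congr' ?_
  filter_upwards [Filter.eventually_ne_atTop 0] with n hn
  have hn' : (n : ℝ) ≠ 0 := mod_cast hn
  have hn1 : (n : ℝ) + 1 ≠ 0 := by positivity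
  rw [Real.rpow_def_of_pos (mod_cast L_pos hn)]
  simp only [Function.comp_apply, Nat.add_sub_cancel]
  congr 1
  push_cast
  field_simp
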